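/- Let G be a finite connected simple graph with edge set E containing at least one edge, and let E_m ⊆ E be any subset. Let P_U = conv{1_{E∖T} : T the edge set of a spanning tree of G} ⊆ ℝ^E and Δ̃_{E_m} = conv({0} ∪ {e_f : f ∈ E_m}). Then the lattice points of the Minkowski sum P = P_U + Δ̃_{E_m} are exactly the vectors of the form v + v′ where v = 1_{E∖T} for some spanning tree T of G and v′ ∈ {0} ∪ {e_f : f ∈ E_m}; i.e. P ∩ ℤ^E = {1_{E∖T} + v′ : T a spanning tree of G, v′ ∈ {0} ∪ {e_f : f ∈ E_m}}. -/

import Mathlib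

open scoped Pointwise
open Classical

noncomputable section

/-- `T` is the edge set of a spanning tree of `G`. -/
def IsSpanningTreeEdges {V : Type*} (G : SimpleGraph V) (T : Set (Sym2 V)) : Prop :=
  T ⊆ G.edgeSet ∧ (SimpleGraph.fromEdgeSet T).IsTree

/-- `F` is the edge set of a spanning two-forest of `G`: a spanning subgraph that is
acyclic and has exactly two connected components. -/
def IsSpanningTwoForestEdges {V : Type*} (G : SimpleGraph V) (F : Set (Sym2 V)) : Prop :=
  F ⊆ G.edgeSet ∧ (SimpleGraph.fromEdgeSet F).IsAcyclic ∧
    Nat.card (SimpleGraph.fromEdgeSet F).ConnectedComponent = 2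

/-- The indicator vector of `E ∖ S` in `ℝ^E`, where `E` is the edge set of `G`. -/
def coIndicator {V : Type*} (G : SimpleGraph V) (S : Set (Sym2 V)) : G.edgeSet → ℝ :=
  fun e => if (e : Sym2 V) ∈ S then 0 else 1

/-- The standard basis vector indexed by `f`. -/
def stdVec {ι : Type*} (f : ι) : ι → ℝ := fun e => if e = f then 1 else 0

/-- `x` is a lattice point (all coordinates are integers). -/
def IsLatticePt {ι : Type*} (x : ι → ℝ) : Prop := ∀ i, ∃ n : ℤ, x i = (n : ℝ)

/-- The integer decomposition property for a set `P ⊆ ℝ^ι`. -/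
def HasIDP {ι : Type*} (P : Set (ι → ℝ)) : Prop :=
  ∀ k : ℕ, 1 ≤ k →
    ((k : ℝ) • P) ∩ {x | IsLatticePt x} =
      ((((k - 1 : ℕ) : ℝ) • P) ∩ {x | IsLatticePt x}) + (P ∩ {x | IsLatticePt x})

theorem sum_one_sub_coIndicator {V : Type*} [Fintype V] {G : SimpleGraph V} {T : Set (Sym2 V)}
    (hT : IsSpanningTreeEdges G T) :
    ∑ e, (1 - coIndicator G T e) = (Fintype.card V : ℝ) - 1 := by
  have hset : (SimpleGraph.fromEdgeSet T).edgeSet = T := by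
    rw [SimpleGraph.edgeSet_fromEdgeSet, sdiff_eq_left, Set.disjoint_left]
    exact fun e he => G.not_isDiag_of_mem_edgeSet (hT.1 he)
  have hcard := hT.2.card_edgeFinset
  have hfin : (SimpleGraph.fromEdgeSet T).edgeFinset =
      (Finset.univ.filter fun e : G.edgeSet => (e : Sym2 V) ∈ T).map
        (Function.Embedding.subtype _) := by
    ext e
    simp only [SimpleGraph.mem_edgeFinset, hset, Finset.mem_map, Finset.mem_filter,
      Finset.mem_univ, true_and, Function.Embedding.subtype_apply]
    exact ⟨fun h => ⟨⟨e, hT.1 h⟩, h, rfl⟩, by rintro ⟨a, ha, rfl⟩; exact ha⟩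
  rw [hfin, Finset.card_map] at hcard
  have hsum : ∑ e, (1 - coIndicator G T e) =
      ((Finset.univ.filter fun e : G.edgeSet => (e : Sym2 V) ∈ T).card : ℝ) := by
    rw [Finset.card_filter, Nat.cast_sum]
    refine Finset.sum_congr rfl fun e _ => ?_
    unfold coIndicator
    split_ifs <;> simp
  rw [hsum, ← hcard]
  push_cast
  ring

/-- A point in the convex hull of a set of points of the unit cube, all of coordinate sum `s`,
gives positive weight to one of these points. -/
theorem exists_pos_weight_of_mem_convexHull {ι : Type*} [Fintype ι] {A : Set (ι → ℝ)} {s : ℝ}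
    (hA : ∀ v ∈ A, ∀ i, 0 ≤ v i ∧ v i ≤ 1) (hs : ∀ v ∈ A, ∑ i, v i = s) {p : ι → ℝ}
    (hp : p ∈ convexHull ℝ A) :
    ∑ i, p i = s ∧ ∃ v ∈ A, ∃ c : ℝ, 0 < c ∧ ∀ i, c * v i ≤ p i ∧ c * (1 - v i) ≤ 1 - p i := by
  refine convexHull_min (t := {p | ∑ i, p i = s ∧ ∃ v ∈ A, ∃ c : ℝ, 0 < c ∧
    ∀ i, c * v i ≤ p i ∧ c * (1 - v i) ≤ 1 - p i}) ?_ ?_ hp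
  · exact fun v hv => ⟨hs v hv, v, hv, 1, one_pos, fun i => by simp⟩
  · rintro p ⟨hps, v, hv, c, hc, h⟩ q ⟨hqs, w, hw, d, hd, k⟩ a b ha hb hab
    refine ⟨?_, ?_⟩
    · simp only [Pi.add_apply, Pi.smul_apply, smul_eq_mul, Finset.sum_add_distrib,
        ← Finset.mul_sum, hps, hqs, ← add_mul, hab, one_mul]
    · rcases ha.eq_or_lt with rfl | ha'
      · obtain rfl : b = 1 := by linarith
        exact ⟨w, hw, d, hd, by simpa using k⟩
      · refine ⟨v, hv, a * c, mul_pos ha' hc, fun i => ?_⟩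
        have hq0 : 0 ≤ q i := (mul_nonneg hd.le (hA w hw i).1).trans (k i).1
        have hq1 : 0 ≤ 1 - q i := (mul_nonneg hd.le (sub_nonneg.2 (hA w hw i).2)).trans (k i).2
        have h1 := mul_le_mul_of_nonneg_left (h i).1 ha
        have h2 := mul_le_mul_of_nonneg_left (h i).2 ha
        have h3 := mul_nonneg hb hq0
        have h4 := mul_nonneg hb hq1
        simp only [Pi.add_apply, Pi.smul_apply, smul_eq_mul]
        exact ⟨by linarith, by linarith⟩

theorem of_mem_convexHull_insert_zero_stdVec {ι : Type*} [Fintype ι] {S : Set ι} {q : ι → ℝ}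
    (hq : q ∈ convexHull ℝ ({0} ∪ {x : ι → ℝ | ∃ f ∈ S, x = stdVec f})) :
    (∀ i, 0 ≤ q i) ∧ ∑ i, q i ≤ 1 ∧ ∀ i, i ∉ S → q i = 0 := by
  refine convexHull_min (t := {q | (∀ i, 0 ≤ q i) ∧ ∑ i, q i ≤ 1 ∧ ∀ i, i ∉ S → q i = 0})
    ?_ ?_ hq
  · rintro x (rfl | ⟨f, hf, rfl⟩)
    · simp
    · refine ⟨fun i => ?_, by simp [stdVec], fun i hi => ?_⟩
      · unfold stdVec
        split_ifs <;> simp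
      · exact if_neg (ne_of_mem_of_not_mem hf hi).symm
  · rintro p ⟨hp, hps, hpS⟩ q ⟨hq, hqs, hqS⟩ a b ha hb hab
    refine ⟨fun i => ?_, ?_, fun i hi => ?_⟩
    · exact add_nonneg (mul_nonneg ha (hp i)) (mul_nonneg hb (hq i))
    · simp only [Pi.add_apply, Pi.smul_apply, smul_eq_mul, Finset.sum_add_distrib,
        ← Finset.mul_sum]
      nlinarith
    · simp [hpS i hi, hqS i hi]

theorem IsLatticePt.exists_int_sum {ι : Type*} [Fintype ι] {x : ι → ℝ} (hx : IsLatticePt x) :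
    ∃ n : ℤ, ∑ i, x i = n := by
  choose n hn using hx
  exact ⟨∑ i, n i, by simp [hn]⟩

theorem int_eq_zero_or_one {y : ℝ} (hy : ∃ n : ℤ, y = n) (h0 : 0 ≤ y) (h2 : y < 2) :
    y = 0 ∨ y = 1 := by
  obtain ⟨n, rfl⟩ := hy
  have h0' : 0 ≤ n := by exact_mod_cast h0
  have h2' : n < 2 := by exact_mod_cast h2
  obtain rfl | rfl : n = 0 ∨ n = 1 := by omega
  all_goals simp

theorem coIndicator_eq_zero_or_one {V : Type*} (G : SimpleGraph V) (T : Set (Sym2 V))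
    (e : G.edgeSet) : coIndicator G T e = 0 ∨ coIndicator G T e = 1 := by
  unfold coIndicator
  split_ifs <;> simp

theorem eq_stdVec_of_sum_eq_one {ι : Type*} [Fintype ι] {q : ι → ℝ} (h0 : ∀ i, 0 ≤ q i)
    (hs : ∑ i, q i = 1) {f : ι} (hf : q f = 1) : q = stdVec f := by
  have hrest : ∑ i ∈ Finset.univ.erase f, q i = 0 := by
    have := Finset.add_sum_erase Finset.univ q (Finset.mem_univ f)
    linarith
  funext i
  by_cases hi : i = f
  · simp [stdVec, hi, hf]
  · simpa [stdVec, hi] using (Finset.sum_eq_zero_iff_of_nonneg fun i _ => h0 i).1 hrest i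
      (by simp [hi])

theorem isLatticePt_coIndicator {V : Type*} (G : SimpleGraph V) (T : Set (Sym2 V)) :
    IsLatticePt (coIndicator G T) := fun e => by
  rcases coIndicator_eq_zero_or_one G T e with h | h
  · exact ⟨0, by simp [h]⟩
  · exact ⟨1, by simp [h]⟩

theorem isLatticePt_stdVec {ι : Type*} (f : ι) : IsLatticePt (stdVec f) := fun i => by
  by_cases h : i = f
  · exact ⟨1, by simp [stdVec, h]⟩
  · exact ⟨0, by simp [stdVec, h]⟩

theorem IsLatticePt.add {ι : Type*} {x y : ι → ℝ} (hx : IsLatticePt x) (hy : IsLatticePt y) :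
    IsLatticePt (x + y) := fun i => by
  obtain ⟨m, hm⟩ := hx i
  obtain ⟨n, hn⟩ := hy i
  exact ⟨m + n, by simp [hm, hn]⟩

theorem IsLatticePt.sub {ι : Type*} {x y : ι → ℝ} (hx : IsLatticePt x) (hy : IsLatticePt y) :
    IsLatticePt (x - y) := fun i => by
  obtain ⟨m, hm⟩ := hx i
  obtain ⟨n, hn⟩ := hy i
  exact ⟨m - n, by simp [hm, hn]⟩

/-- A lattice point of the unit cube equals each `0`/`1`-vector `v` to which it gives positive
weight `c`. -/
theorem IsLatticePt.eq_of_pos_weight {ι : Type*} {p v : ι → ℝ} {c : ℝ} (hp : IsLatticePt p)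
    (hv : ∀ i, v i = 0 ∨ v i = 1) (hc : 0 < c)
    (h : ∀ i, c * v i ≤ p i ∧ c * (1 - v i) ≤ 1 - p i) : p = v := by
  funext i
  obtain ⟨h1, h2⟩ := h i
  rcases hv i with hi | hi <;> rw [hi] at h1 h2 ⊢
  · rcases int_eq_zero_or_one (hp i) (by linarith) (by linarith) with h' | h' <;> linarith
  · rcases int_eq_zero_or_one (hp i) (by linarith) (by linarith) with h' | h' <;> linarith

/-- (Walther's lemma.)  For a connected graph `G` with at least one edge and
any subset `E_m` of the edges, the lattice points of `P_U + Δ̃_{E_m}` are exactly the sums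
`1_{E∖T} + v′` with `T` a spanning tree and `v′ ∈ {0} ∪ {e_f : f ∈ E_m}`. -/
theorem lattice_points_of_massive_polytope {V : Type*} [Fintype V] (G : SimpleGraph V)
    (hconn : G.Connected) (hE : G.edgeSet.Nonempty) (Em : Set G.edgeSet) :
    ((convexHull ℝ {x : G.edgeSet → ℝ | ∃ T, IsSpanningTreeEdges G T ∧ x = coIndicator G T}) +
        convexHull ℝ ({0} ∪ {x : G.edgeSet → ℝ | ∃ f ∈ Em, x = stdVec f})) ∩
        {x | IsLatticePt x} =
      {x : G.edgeSet → ℝ | ∃ T, IsSpanningTreeEdges G T ∧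
        (x = coIndicator G T ∨ ∃ f ∈ Em, x = coIndicator G T + stdVec f)} := by
  ext x
  constructor
  · rintro ⟨⟨p, hp, q, hq, rfl⟩, hx⟩
    replace hx : IsLatticePt (p + q) := hx
    obtain ⟨hq0, hq1, hqS⟩ := of_mem_convexHull_insert_zero_stdVec hq
    obtain ⟨hps, v, ⟨T, hT, rfl⟩, c, hc, hpT⟩ :=
      exists_pos_weight_of_mem_convexHull
        (s := (Fintype.card G.edgeSet : ℝ) - ((Fintype.card V : ℝ) - 1))
        (by
          rintro _ ⟨T, -, rfl⟩ e
          rcases coIndicator_eq_zero_or_one G T e with h | h <;> simp [h])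
        (by
          rintro _ ⟨T, hT, rfl⟩
          rw [← sum_one_sub_coIndicator hT]
          simp) hp
    have hvs := sum_one_sub_coIndicator hT
    have hv := coIndicator_eq_zero_or_one G T
    refine ⟨T, hT, ?_⟩
    have hqs : ∃ n : ℤ, ∑ i, q i = n := by
      obtain ⟨n, hn⟩ := hx.exists_int_sum
      refine ⟨n - (Fintype.card G.edgeSet - (Fintype.card V - 1)), ?_⟩
      simp only [Pi.add_apply, Finset.sum_add_distrib] at hn
      push_cast
      linarith
    rcases int_eq_zero_or_one hqs (Finset.sum_nonneg fun i _ => hq0 i) (by linarith) with h | h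
    · left
      obtain rfl : q = 0 := by
        funext i
        exact (Finset.sum_eq_zero_iff_of_nonneg fun i _ => hq0 i).1 h i (Finset.mem_univ i)
      simp only [add_zero] at hx ⊢
      exact hx.eq_of_pos_weight hv hc hpT
    · right
      by_cases hf : ∃ f, q f = 1
      · obtain ⟨f, hf⟩ := hf
        have hfm : f ∈ Em := by
          by_contra hn
          rw [hqS f hn] at hf
          exact zero_ne_one hf
        have hqf := eq_stdVec_of_sum_eq_one hq0 h hf
        have hpl : IsLatticePt p := by
          simpa [← hqf] using hx.sub (isLatticePt_stdVec f)
        exact ⟨f, hfm, by rw [hqf, hpl.eq_of_pos_weight hv hc hpT]⟩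
      · push Not at hf
        have hle : ∀ i, q i < 1 := fun i =>
          lt_of_le_of_ne ((Finset.single_le_sum (fun i _ => hq0 i) (Finset.mem_univ i)).trans hq1)
            (hf i)
        have hp01 : ∀ i, 0 ≤ p i ∧ p i ≤ 1 := fun i => by
          have := hpT i
          rcases hv i with hi | hi <;> rw [hi] at this <;> constructor <;> linarith
        have hx01 : ∀ i, (p + q) i = 0 ∨ (p + q) i = 1 := fun i =>
          int_eq_zero_or_one (hx i) (add_nonneg (hp01 i).1 (hq0 i))
            (by have := hle i; have := (hp01 i).2; simp only [Pi.add_apply]; linarith)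
        have hd : ∀ i, (p + q - coIndicator G T) i = 0 ∨ (p + q - coIndicator G T) i = 1 := by
          intro i
          have h1 := (hpT i).1
          have h2 := hq0 i
          have h3 := hx01 i
          simp only [Pi.sub_apply, Pi.add_apply] at h3 ⊢
          rcases hv i with hi | hi <;> rw [hi] at h1 ⊢
          · simpa using h3
          · rcases h3 with h3 | h3
            · linarith
            · left
              linarith
        have hds : ∑ i, (p + q - coIndicator G T) i = 1 := by
          simp only [Pi.sub_apply, Pi.add_apply, Finset.sum_sub_distrib, Finset.sum_add_distrib,
            Finset.sum_const, Finset.card_univ, nsmul_eq_mul, mul_one] at hvs ⊢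
          linarith
        obtain ⟨f, hf1⟩ : ∃ f, (p + q - coIndicator G T) f = 1 := by
          by_contra! hn
          rw [Finset.sum_eq_zero fun i _ => (hd i).resolve_right (hn i)] at hds
          exact zero_ne_one hds
        have hdf := eq_stdVec_of_sum_eq_one
          (fun i => by rcases hd i with h | h <;> rw [h]; exact zero_le_one) hds hf1
        refine ⟨f, ?_, by rw [← hdf]; simp⟩
        by_contra hn
        have hqf := hqS f hn
        have h1 := (hpT f).2
        simp only [Pi.sub_apply, Pi.add_apply, hqf] at hf1
        rcases hv f with hi | hi <;> rw [hi] at h1 hf1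
        · linarith
        · linarith [(hp01 f).2]
  · rintro ⟨T, hT, hx⟩
    have hmem := subset_convexHull ℝ
      {x : G.edgeSet → ℝ | ∃ T, IsSpanningTreeEdges G T ∧ x = coIndicator G T} ⟨T, hT, rfl⟩
    rcases hx with rfl | ⟨f, hf, rfl⟩
    · refine ⟨⟨_, hmem, 0, subset_convexHull ℝ _ (Or.inl rfl), add_zero _⟩, ?_⟩
      exact isLatticePt_coIndicator G T
    · refine ⟨⟨_, hmem, _, subset_convexHull ℝ _ (Or.inr ⟨f, hf, rfl⟩), rfl⟩, ?_⟩
      exact (isLatticePt_coIndicator G T).add (isLatticePt_stdVec f)
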